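/- Theorem 2, location of first infeasibility (n₀ ≤ N): assume the feasibility condition T ≥ s_k + (N − k + 1)·d for every 1 ≤ k ≤ N. If the algorithm output x̄ satisfies x̄_i ≥ 2d for every 2 ≤ i ≤ N, then necessarily x̄_{N+1} ≥ d; in other words, the first index at which x̄ violates the service-time constraints of the full single-user problem, if any, is at most N. -/

import Mathlib

open Finset

/-- The quantity `g_m(j)` of the Inter-Update Balancing algorithm, as a function of the
previous block-end index `p = i_{m−1}` and the candidate index `j`:
`g(p, j) = (s_j − s_p)/(j − p)` for `j ≤ N` and `g(p, N+1) = (T − d − s_p)/(N + 1 − p)`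
(with the convention `s_0 = 0` imposed as a hypothesis). -/
noncomputable def gBal (N : ℕ) (d T : ℝ) (s : ℕ → ℝ) (p j : ℕ) : ℝ :=
  if j = N + 1 then (T - d - s p) / ((N : ℝ) + 1 - p)
  else (s j - s p) / ((j : ℝ) - p)

/-- `IUBRun N d T s M idx xbar` says that `idx 0 = 0 < idx 1 < … < idx M = N+1` is the
sequence of block-end indices produced by the Inter-Update Balancing algorithm (each
`idx (m+1)` is the largest maximizer of `gBal (idx m)` over `{idx m + 1, …, N+1}`), and
`xbar` is the corresponding output: `xbar i = g_m(i_m) + d` for `i_{m−1} < i ≤ i_m`. -/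
def IUBRun (N : ℕ) (d T : ℝ) (s : ℕ → ℝ) (M : ℕ) (idx : ℕ → ℕ) (xbar : ℕ → ℝ) : Prop :=
  idx 0 = 0 ∧ idx M = N + 1 ∧
  (∀ m, m < M → idx m < N + 1) ∧
  (∀ m, m < M → idx m < idx (m + 1) ∧ idx (m + 1) ≤ N + 1) ∧
  (∀ m, m < M → ∀ j, idx m < j → j ≤ N + 1 →
    gBal N d T s (idx m) j ≤ gBal N d T s (idx m) (idx (m + 1))) ∧
  (∀ m, m < M → ∀ j, idx m < j → j ≤ N + 1 →
    gBal N d T s (idx m) j = gBal N d T s (idx m) (idx (m + 1)) → j ≤ idx (m + 1)) ∧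
  (∀ m, m < M → ∀ i, idx m < i → i ≤ idx (m + 1) →
    xbar i = gBal N d T s (idx m) (idx (m + 1)) + d)

/-- **Theorem 2, location of first infeasibility `n₀ ≤ N`.** Under the
feasibility condition `T ≥ s_k + (N−k+1)d` for all `1 ≤ k ≤ N`, if the algorithm output
`x̄` satisfies `x̄_i ≥ 2d` for every `2 ≤ i ≤ N`, then necessarily `x̄_{N+1} ≥ d`; i.e.,
the first index violating the service-time constraints, if any, is at most `N`. -/
theorem theorem2_first_infeasibility_at_most_N
    (N : ℕ) (hN : 2 ≤ N) (d T : ℝ) (hd : 0 < d)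
    (s : ℕ → ℝ) (hs0 : s 0 = 0) (hs1 : 0 ≤ s 1)
    (hmono : ∀ i, 1 ≤ i → i < N → s i ≤ s (i + 1))
    (hfeascond : ∀ k, 1 ≤ k → k ≤ N → s k + ((N : ℝ) - k + 1) * d ≤ T)
    (M : ℕ) (idx : ℕ → ℕ) (xbar : ℕ → ℝ)
    (hrun : IUBRun N d T s M idx xbar)
    (h2d : ∀ i, 2 ≤ i → i ≤ N → 2 * d ≤ xbar i) :
    d ≤ xbar (N + 1) := by
  obtain ⟨hidx0, hidxM, hlt, -, -, -, hx⟩ := hrun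
  obtain _ | k := M
  · omega
  have hp := hlt k k.lt_succ_self
  have hpN : (idx k : ℝ) ≤ N := by exact_mod_cast Nat.lt_succ_iff.mp hp
  have hT : s (idx k) + d ≤ T := by
    rcases Nat.eq_zero_or_pos (idx k) with h0 | hpos
    · have hN' : (2 : ℝ) ≤ N := by exact_mod_cast hN
      have h1 := hfeascond 1 le_rfl (by omega)
      rw [h0, hs0]
      push_cast at h1
      nlinarith
    · have h1 := hfeascond (idx k) hpos (by omega)
      nlinarith
  rw [hx k k.lt_succ_self (N + 1) hp hidxM.ge, hidxM, gBal, if_pos rfl]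
  have : 0 ≤ (T - d - s (idx k)) / ((N : ℝ) + 1 - idx k) :=
    div_nonneg (by linarith) (by linarith)
  linarith
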